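/- arXiv:2410.08579 — 2 statements merged into one kernel-verified Lean document; each statement's English description precedes it below -/
import Mathlib

section
/- Let f be a Tate analytic self-map of o_K^m over a p-adic local field K with ‖f − id‖ ≤ p^{−c}, c > 1/(p−1), and let T_f: g ↦ g∘f be the precomposition operator on the Banach space o_K⟨x⟩^m. Then ‖T_f − Id‖_op ≤ ‖f − id‖, where ‖·‖_op is the operator norm with respect to the Gauss norm. -/
open Filter

section Aux
set_option linter.unusedSectionVars false
variable {K : Type*} [NormedField K] [CompleteSpace K] [IsUltrametricDist K] {m : ℕ}

/-- monomial -/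
def auxMon (x : Fin m → K) (I : Fin m → ℕ) : K := ∏ j, x j ^ I j

/-- `F` is represented on the unit polydisk by a Tate series of Gauss norm at most `r`. -/
def auxRep (F : (Fin m → K) → K) (r : ℝ) : Prop :=
  ∃ a : (Fin m → ℕ) → K, Tendsto (fun I => ‖a I‖) cofinite (nhds 0) ∧ (∀ I, ‖a I‖ ≤ r) ∧
    ∀ x : Fin m → K, (∀ j, ‖x j‖ ≤ 1) → F x = ∑' I, a I * auxMon x I

lemma auxMon_le {x : Fin m → K} (hx : ∀ j, ‖x j‖ ≤ 1) (I : Fin m → ℕ) : ‖auxMon x I‖ ≤ 1 := by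
  unfold auxMon
  rw [norm_prod]
  refine Finset.prod_le_one (fun _ _ => norm_nonneg _) (fun j _ => ?_)
  rw [norm_pow]
  exact pow_le_one₀ (norm_nonneg _) (hx j)

lemma auxMon_add (x : Fin m → K) (I J : Fin m → ℕ) :
    auxMon x (I + J) = auxMon x I * auxMon x J := by
  simp [auxMon, pow_add, Finset.prod_mul_distrib]

lemma aux_summable {S : Type*} {c : S → K} (hc : Tendsto (fun s => ‖c s‖) cofinite (nhds 0))
    {u : S → K} (hu : ∀ s, ‖u s‖ ≤ 1) : Summable (fun s => c s * u s) := by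
  apply NonarchimedeanAddGroup.summable_of_tendsto_cofinite_zero
  rw [tendsto_zero_iff_norm_tendsto_zero]
  refine squeeze_zero (fun _ => norm_nonneg _) (fun s => ?_) hc
  rw [norm_mul]
  exact mul_le_of_le_one_right (norm_nonneg _) (hu s)

lemma aux_norm_tsum_le {S : Type*} {c : S → K} {r : ℝ} (hr : 0 ≤ r) (h : ∀ s, ‖c s‖ ≤ r) :
    ‖∑' s, c s‖ ≤ r := by
  exact IsUltrametricDist.norm_tsum_le_of_forall_le_of_nonneg hr h

lemma aux_finite {S : Type*} {c : S → ℝ} (h0 : ∀ s, 0 ≤ c s) :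
    Tendsto c cofinite (nhds 0) ↔ ∀ ε > 0, {s | ε ≤ c s}.Finite := by
  rw [Metric.tendsto_nhds]
  simp only [Filter.eventually_cofinite, Real.dist_eq, sub_zero, not_lt, abs_of_nonneg (h0 _)]

lemma auxRep_of_family {S : Type*} {c : S → K} (e : S → (Fin m → ℕ)) {r : ℝ} (hr : 0 ≤ r)
    (hc : Tendsto (fun s => ‖c s‖) cofinite (nhds 0)) (hcr : ∀ s, ‖c s‖ ≤ r)
    {F : (Fin m → K) → K}
    (hF : ∀ x : Fin m → K, (∀ j, ‖x j‖ ≤ 1) → F x = ∑' s, c s * auxMon x (e s)) :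
    auxRep F r := by
  refine ⟨fun L => ∑' s : e ⁻¹' {L}, c s, ?_, fun L => aux_norm_tsum_le hr fun s => hcr s, ?_⟩
  · rw [aux_finite (fun _ => norm_nonneg _)] at hc ⊢
    intro ε hε
    refine ((hc (ε / 2) (by positivity)).image e).subset ?_
    intro L hL
    by_contra hcon
    have : ‖∑' s : e ⁻¹' {L}, c s‖ ≤ ε / 2 := by
      refine aux_norm_tsum_le (by positivity) fun s => ?_
      by_contra hs
      exact hcon ⟨s, (not_le.mp hs).le, s.2⟩
    have h2 : ε ≤ ‖∑' s : e ⁻¹' {L}, c s‖ := hL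
    linarith
  · intro x hx
    rw [hF x hx]
    have hs : Summable (fun s => c s * auxMon x (e s)) := aux_summable hc fun s => auxMon_le hx _
    have h1 := (Equiv.sigmaFiberEquiv e).tsum_eq (fun s => c s * auxMon x (e s))
    rw [← h1]
    have hs' := (Equiv.sigmaFiberEquiv e).summable_iff.mpr hs
    refine (Summable.tsum_sigma hs').trans ?_
    refine tsum_congr fun L => ?_
    rw [← tsum_mul_right]
    refine tsum_congr fun s => ?_
    have : e s.1 = L := s.2
    simp [Equiv.sigmaFiberEquiv, this]

lemma auxRep.nonneg {F : (Fin m → K) → K} {r : ℝ} (h : auxRep F r) : 0 ≤ r := by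
  obtain ⟨a, -, h, -⟩ := h
  exact (norm_nonneg _).trans (h 0)

lemma auxRep.bound {F : (Fin m → K) → K} {r : ℝ} (h : auxRep F r)
    {x : Fin m → K} (hx : ∀ j, ‖x j‖ ≤ 1) : ‖F x‖ ≤ r := by
  have h0 := h.nonneg
  obtain ⟨a, -, h, h'⟩ := h
  rw [h' x hx]
  refine aux_norm_tsum_le h0 fun s => ?_
  rw [norm_mul]
  exact (mul_le_of_le_one_right (norm_nonneg _) (auxMon_le hx s)).trans (h s)

lemma auxRep.add {F G : (Fin m → K) → K} {r : ℝ} (hF : auxRep F r) (hG : auxRep G r) :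
    auxRep (fun x => F x + G x) r := by
  obtain ⟨a, ha, har, haF⟩ := hF
  obtain ⟨b, hb, hbr, hbG⟩ := hG
  refine ⟨fun I => a I + b I, ?_, ?_, ?_⟩
  · rw [← tendsto_zero_iff_norm_tendsto_zero] at *
    simpa using ha.add hb
  · intro I
    exact (IsUltrametricDist.norm_add_le_max _ _).trans (max_le (har I) (hbr I))
  · intro x hx
    simp only []
    rw [haF x hx, hbG x hx, ← Summable.tsum_add (aux_summable ha (auxMon_le hx))
      (aux_summable hb (auxMon_le hx))]
    simp [add_mul]

lemma auxRep.smul {F : (Fin m → K) → K} {r : ℝ} (hF : auxRep F r) (k : K) :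
    auxRep (fun x => k * F x) (‖k‖ * r) := by
  obtain ⟨a, ha, har, haF⟩ := hF
  refine ⟨fun I => k * a I, ?_, ?_, ?_⟩
  · simpa using ha.const_mul ‖k‖
  · intro I
    rw [norm_mul]
    exact mul_le_mul_of_nonneg_left (har I) (norm_nonneg _)
  · intro x hx
    simp only [mul_assoc]
    rw [haF x hx, tsum_mul_left]

lemma aux_summable_mul {S T : Type*} {f : S → K} {g : T → K} (hf : Summable f)
    (hg : Summable g) : Summable (fun q : S × T => f q.1 * g q.2) := by
  have : NonarchimedeanRing K := { is_nonarchimedean := NonarchimedeanAddGroup.is_nonarchimedean }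
  exact hf.mul_of_nonarchimedean hg

lemma aux_tsum_mul {S T : Type*} {f : S → K} {g : T → K} (hf : Summable f)
    (hg : Summable g) : (∑' s, f s) * (∑' t, g t) = ∑' q : S × T, f q.1 * g q.2 := by
  have : NonarchimedeanRing K := { is_nonarchimedean := NonarchimedeanAddGroup.is_nonarchimedean }
  exact tsum_mul_tsum_of_nonarchimedean hf hg

lemma auxRep.mul {F G : (Fin m → K) → K} {r s : ℝ} (hF : auxRep F r) (hG : auxRep G s) :
    auxRep (fun x => F x * G x) (r * s) := by
  have hr := hF.nonneg
  have hs := hG.nonneg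
  obtain ⟨a, ha, har, haF⟩ := hF
  obtain ⟨b, hb, hbr, hbG⟩ := hG
  refine auxRep_of_family (S := (Fin m → ℕ) × (Fin m → ℕ)) (c := fun q => a q.1 * b q.2)
    (fun q => q.1 + q.2) (mul_nonneg hr hs) ?_ ?_ ?_
  · rw [← tendsto_zero_iff_norm_tendsto_zero] at *
    have h1 := NonarchimedeanAddGroup.summable_of_tendsto_cofinite_zero ha
    have h2 := NonarchimedeanAddGroup.summable_of_tendsto_cofinite_zero hb
    exact (aux_summable_mul h1 h2).tendsto_cofinite_zero
  · intro q
    rw [norm_mul]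
    exact mul_le_mul (har _) (hbr _) (norm_nonneg _) hr
  · intro x hx
    rw [haF x hx, hbG x hx]
    have h1 := aux_summable ha (auxMon_le hx)
    have h2 := aux_summable hb (auxMon_le hx)
    rw [aux_tsum_mul h1 h2]
    refine tsum_congr fun q => ?_
    rw [auxMon_add]
    ring

lemma auxRep.tsum {ι : Type*} {F : ι → (Fin m → K) → K} {r : ι → ℝ} {R : ℝ} (hR : 0 ≤ R)
    (hF : ∀ n, auxRep (F n) (r n)) (hr : Tendsto r cofinite (nhds 0)) (hrR : ∀ n, r n ≤ R) :
    auxRep (fun x => ∑' n, F n x) R := by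
  have hr0 := fun n => (hF n).nonneg
  choose a ha har haF using hF
  have hdec : Tendsto (fun q : ι × (Fin m → ℕ) => ‖a q.1 q.2‖) cofinite (nhds 0) := by
    rw [aux_finite (fun _ => norm_nonneg _)]
    rw [aux_finite hr0] at hr
    intro ε hε
    refine ((hr ε hε).biUnion (t := fun n => Prod.mk n '' {I | ε ≤ ‖a n I‖})
      fun n _ => ((aux_finite (fun _ => norm_nonneg _)).mp (ha n) ε hε).image _).subset ?_
    rintro ⟨n, I⟩ h
    have h : ε ≤ ‖a n I‖ := h
    simp only [Set.mem_iUnion]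
    exact ⟨n, h.trans (har n I), I, h, rfl⟩
  refine auxRep_of_family (c := fun q : ι × (Fin m → ℕ) => a q.1 q.2) (fun q => q.2) hR hdec
    (fun q => (har _ _).trans (hrR _)) ?_
  intro x hx
  have hs := aux_summable hdec (u := fun q => auxMon x q.2) fun s => auxMon_le hx _
  rw [hs.tsum_prod]
  exact tsum_congr fun n => haF n x hx

/-- pairs of functions of norm at most one which are `ε`-close -/
def auxPair (ε : ℝ) (F G : (Fin m → K) → K) : Prop :=
  auxRep F 1 ∧ auxRep G 1 ∧ auxRep (fun x => F x - G x) ε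

lemma auxPair.mul {ε : ℝ} {F G F' G' : (Fin m → K) → K} (h : auxPair ε F G)
    (h' : auxPair ε F' G') : auxPair ε (fun x => F x * F' x) (fun x => G x * G' x) := by
  refine ⟨by simpa using h.1.mul h'.1, by simpa using h.2.1.mul h'.2.1, ?_⟩
  have h1 := h.1.mul h'.2.2
  have h2 := h.2.2.mul h'.2.1
  rw [one_mul] at h1
  rw [mul_one] at h2
  convert h1.add h2 using 2
  ring

lemma auxRep_mon (I : Fin m → ℕ) : auxRep (K := K) (fun x => auxMon x I) 1 := by
  refine ⟨fun J => if J = I then 1 else 0, ?_, ?_, ?_⟩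
  · refine tendsto_const_nhds.congr' ?_
    rw [EventuallyEq, eventually_cofinite]
    refine (Set.finite_singleton I).subset fun J hJ => ?_
    by_contra h
    have h : J ≠ I := h
    simp [h] at hJ
  · intro J
    by_cases h : J = I <;> simp [h]
  · intro x _
    simp [tsum_eq_single I]

lemma auxPair_one {ε : ℝ} (hε : 0 ≤ ε) :
    auxPair (K := K) (m := m) ε (fun _ => 1) (fun _ => 1) := by
  have h : auxRep (K := K) (m := m) (fun _ => 1) 1 := by
    simpa [auxMon] using auxRep_mon (K := K) (m := m) 0
  refine ⟨h, h, ⟨fun _ => 0, ?_, ?_, ?_⟩⟩ <;> simp [hε, tendsto_const_nhds]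

lemma auxPair.pow {ε : ℝ} (hε : 0 ≤ ε) {F G : (Fin m → K) → K} (h : auxPair ε F G) (n : ℕ) :
    auxPair ε (fun x => F x ^ n) (fun x => G x ^ n) := by
  induction n with
  | zero => simpa using auxPair_one hε
  | succ n ih => simpa only [pow_succ] using ih.mul h

lemma auxPair.prod {ε : ℝ} (hε : 0 ≤ ε) {ι : Type*} (s : Finset ι) {F G : ι → (Fin m → K) → K}
    (h : ∀ i, auxPair ε (F i) (G i)) :
    auxPair ε (fun x => ∏ i ∈ s, F i x) (fun x => ∏ i ∈ s, G i x) := by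
  classical
  induction s using Finset.induction_on with
  | empty => simpa using auxPair_one hε
  | insert a s ha ih => simpa only [Finset.prod_insert ha] using (h a).mul ih

end Aux


/-- for a Tate-analytic self-map f of the unit polydisk of a p-adic local
field K with ‖f − id‖ ≤ p^{−c}, c > 1/(p−1) (Gauss norm on coefficients), the
precomposition operator T_f satisfies ‖T_f − Id‖_op ≤ ‖f − id‖: for every Tate series g
with coefficients in the unit ball, g∘f − g is a Tate series whose Gauss norm is at most
‖f − id‖·‖g‖. -/
theorem stmt7 (p : ℕ) [Fact p.Prime]
    {K : Type*} [NormedField K] [CompleteSpace K] [IsUltrametricDist K]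
    [Algebra ℚ_[p] K] [FiniteDimensional ℚ_[p] K]
    (hKnorm : ∀ x : ℚ_[p], ‖algebraMap ℚ_[p] K x‖ = ‖x‖)
    (m : ℕ) (c : ℝ) (hc : 1 / ((p : ℝ) - 1) < c)
    (cf : (Fin m → ℕ) → Fin m → K)
    (hcf1 : ∀ I i, ‖cf I i‖ ≤ 1)
    (hcfdecay : ∀ i, Tendsto (fun I => ‖cf I i‖) cofinite (nhds 0))
    (hnear : ∀ I i,
      ‖cf I i - (if I = Pi.single i 1 then 1 else 0)‖ ≤ (p : ℝ) ^ (-c)) :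
    ∀ cg : (Fin m → ℕ) → Fin m → K,
      (∀ I i, ‖cg I i‖ ≤ 1) →
      (∀ i, Tendsto (fun I => ‖cg I i‖) cofinite (nhds 0)) →
      ∃ d : (Fin m → ℕ) → Fin m → K,
        (∀ i, Tendsto (fun I => ‖d I i‖) cofinite (nhds 0)) ∧
        (∀ x : Fin m → K, (∀ j, ‖x j‖ ≤ 1) → ∀ i,
          (∑' I : Fin m → ℕ, d I i * ∏ j, x j ^ I j)
            = (∑' I : Fin m → ℕ, cg I i *
                ∏ j, (∑' J : Fin m → ℕ, cf J j * ∏ l, x l ^ J l) ^ I j)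
              - ∑' I : Fin m → ℕ, cg I i * ∏ j, x j ^ I j) ∧
        (∀ I i, ‖d I i‖ ≤
          (⨆ q : (Fin m → ℕ) × Fin m,
            ‖cf q.1 q.2 - (if q.1 = Pi.single q.2 1 then 1 else 0)‖) *
          (⨆ q : (Fin m → ℕ) × Fin m, ‖cg q.1 q.2‖)) := by
  intro cg hcg1 hcgd
  set ε := ⨆ q : (Fin m → ℕ) × Fin m,
    ‖cf q.1 q.2 - (if q.1 = Pi.single q.2 1 then 1 else 0)‖ with hεdef
  set R := ⨆ q : (Fin m → ℕ) × Fin m, ‖cg q.1 q.2‖ with hRdef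
  have hε0 : 0 ≤ ε := Real.iSup_nonneg fun _ => norm_nonneg _
  have hR0 : 0 ≤ R := Real.iSup_nonneg fun _ => norm_nonneg _
  have hε : ∀ I i, ‖cf I i - (if I = Pi.single i 1 then 1 else 0)‖ ≤ ε := fun I i =>
    le_ciSup (f := fun q : (Fin m → ℕ) × Fin m =>
      ‖cf q.1 q.2 - (if q.1 = Pi.single q.2 1 then 1 else 0)‖)
      ⟨(p : ℝ) ^ (-c), by rintro _ ⟨q, rfl⟩; exact hnear _ _⟩ (I, i)
  have hR : ∀ I i, ‖cg I i‖ ≤ R := fun I i =>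
    le_ciSup (f := fun q : (Fin m → ℕ) × Fin m => ‖cg q.1 q.2‖)
      ⟨1, by rintro _ ⟨q, rfl⟩; exact hcg1 _ _⟩ (I, i)
  have hmon1 : ∀ (x : Fin m → K) (j : Fin m), auxMon x (Pi.single j 1) = x j := by
    intro x j
    unfold auxMon
    rw [Finset.prod_eq_single j]
    · simp
    · intro b _ hb
      simp [Pi.single_eq_of_ne hb]
    · simp
  have hpair : ∀ j, auxPair (K := K) ε
      (fun x => ∑' J : Fin m → ℕ, cf J j * ∏ l, x l ^ J l) (fun x => x j) := by
    intro j
    have hx1 : auxRep (K := K) (fun x : Fin m → K => x j) 1 := by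
      simpa only [hmon1] using auxRep_mon (K := K) (Pi.single j 1)
    have hf1 : auxRep (K := K)
        (fun x : Fin m → K => ∑' J : Fin m → ℕ, cf J j * ∏ l, x l ^ J l) 1 :=
      ⟨fun J => cf J j, hcfdecay j, fun J => hcf1 J j, fun x _ => rfl⟩
    refine ⟨hf1, hx1, ⟨fun J => cf J j - (if J = Pi.single j 1 then 1 else 0), ?_,
      fun J => hε J j, ?_⟩⟩
    · refine (hcfdecay j).congr' ?_
      rw [EventuallyEq, eventually_cofinite]
      refine (Set.finite_singleton (Pi.single j 1)).subset fun J hJ => ?_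
      by_contra h
      have h : J ≠ Pi.single j 1 := h
      simp [h] at hJ
    · intro x hx
      have hs := aux_summable (hcfdecay j) (auxMon_le hx)
      have hs2 : HasSum (fun J : Fin m → ℕ =>
          (if J = Pi.single j 1 then (1 : K) else 0) * auxMon x J) (x j) := by
        have := hasSum_single (f := fun J : Fin m → ℕ =>
          (if J = Pi.single j 1 then (1 : K) else 0) * auxMon x J) (Pi.single j 1)
          (fun J hJ => by simp [hJ])
        simpa [hmon1] using this
      simp only [sub_mul]
      rw [hs.tsum_sub hs2.summable, hs2.tsum_eq]
      rfl
  have hpairI : ∀ I : Fin m → ℕ, auxPair (K := K) ε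
      (fun x => ∏ j, (∑' J : Fin m → ℕ, cf J j * ∏ l, x l ^ J l) ^ I j)
      (fun x => ∏ j, x j ^ I j) := fun I =>
    auxPair.prod hε0 Finset.univ fun j => (hpair j).pow hε0 (I j)
  have hrep : ∀ i, auxRep (K := K) (fun x => ∑' I : Fin m → ℕ, cg I i *
      ((∏ j, (∑' J : Fin m → ℕ, cf J j * ∏ l, x l ^ J l) ^ I j) - ∏ j, x j ^ I j)) (ε * R) := by
    intro i
    refine auxRep.tsum (r := fun I => ‖cg I i‖ * ε) (mul_nonneg hε0 hR0)
      (fun I => (hpairI I).2.2.smul (cg I i)) ?_ ?_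
    · simpa using (hcgd i).mul_const ε
    · intro I
      rw [mul_comm]
      exact mul_le_mul_of_nonneg_left (hR I i) hε0
  choose d hd1 hd2 hd3 using hrep
  refine ⟨fun I i => d i I, hd1, ?_, fun I i => hd2 i I⟩
  intro x hx i
  have h := hd3 i x hx
  have hs1 := aux_summable (hcgd i) fun I => (hpairI I).1.bound hx
  have hs2 := aux_summable (hcgd i) fun I => (hpairI I).2.1.bound hx
  rw [← hs1.tsum_sub hs2]
  simp only [mul_sub] at h
  exact h.symm
end

section
/- If a subgroup H of SL_2(Z_p) contains two elements generating a non-abelian free group, then the closure of H in SL_2(Z_p) is an open subgroup. -/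
section
open Matrix
namespace S16
lemma pow_expand {R : Type*} [CommRing R] (A : Matrix (Fin 2) (Fin 2) R) (q : R) (n : ℕ) :
    ∃ α β : R, (1 + q • A) ^ n = (1 + q^2*β) • (1 : Matrix (Fin 2) (Fin 2) R) + (n*q+q^2*α) • A := by
  have hA : A * A = A.trace • A - A.det • (1 : Matrix (Fin 2) (Fin 2) R) := by
    ext i j
    fin_cases i <;> fin_cases j <;> simp [Matrix.mul_apply, Fin.sum_univ_two, Matrix.trace, Matrix.det_fin_two] <;> ring
  induction n with
  | zero => exact ⟨0, 0, by simp⟩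
  | succ n ih =>
    obtain ⟨α, β, h⟩ := ih
    refine ⟨α + q*β + (n + q * α) * A.trace, β - (n + q*α) * A.det, ?_⟩
    rw [pow_succ, h]
    simp only [add_mul, mul_add, smul_mul_assoc, mul_smul_comm, one_mul, mul_one, hA]
    push_cast
    module

variable {p : ℕ} [Fact p.Prime]

lemma pk_expand (g A : Matrix (Fin 2) (Fin 2) ℤ_[p]) (hg : g = 1 + (p:ℤ_[p])^2 • A) (k : ℕ) :
    ∃ β u : ℤ_[p], IsUnit u ∧ g ^ (p^k) = 1 + (p:ℤ_[p])^(k+2) • (β • (1 : Matrix (Fin 2) (Fin 2) ℤ_[p]) + u • A) := by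
  induction k with
  | zero => exact ⟨0, 1, isUnit_one, by simp [hg]⟩
  | succ k ih =>
    obtain ⟨β, u, hu, h⟩ := ih
    obtain ⟨α', β', h'⟩ := pow_expand (β • (1 : Matrix (Fin 2) (Fin 2) ℤ_[p]) + u • A) ((p:ℤ_[p])^(k+2)) p
    refine ⟨(p:ℤ_[p])^(k+1) * β' + (1 + (p:ℤ_[p])^(k+1) * α') * β, (1 + (p:ℤ_[p])^(k+1) * α') * u, ?_, ?_⟩
    · refine IsUnit.mul ?_ hu
      have : (1 + (p:ℤ_[p])^(k+1) * α') = 1 - (-((p:ℤ_[p])^(k+1) * α')) := by ring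
      rw [this]
      apply IsLocalRing.isUnit_one_sub_self_of_mem_nonunits
      rw [mem_nonunits_iff, PadicInt.isUnit_iff]
      have h1 := PadicInt.p_nonunit (p := p)
      intro hh
      apply h1
      have : IsUnit (-((p:ℤ_[p])^(k+1) * α')) := PadicInt.isUnit_iff.2 hh
      refine isUnit_of_dvd_unit ?_ this
      rw [dvd_neg, pow_succ]
      exact Dvd.intro_left (p ^ k * 1 * α') (by ring)
    · rw [pow_succ, pow_mul, h, h']
      module

lemma approx (g A : Matrix (Fin 2) (Fin 2) ℤ_[p]) (hg : g = 1 + (p:ℤ_[p])^2 • A) (k R : ℕ)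
    (hR : R ≤ k + 2) (x : ℤ_[p]) :
    ∃ (n : ℕ) (s : ℤ_[p]) (E : Matrix (Fin 2) (Fin 2) ℤ_[p]),
      g ^ n = 1 + (p:ℤ_[p])^(k+2) • (s • (1 : Matrix (Fin 2) (Fin 2) ℤ_[p]) + x • A) +
        ((p:ℤ_[p])^(k+2) * (p:ℤ_[p])^R) • E := by
  obtain ⟨β, u, ⟨u, rfl⟩, h⟩ := pk_expand g A hg k
  have hm := PadicInt.appr_spec R (x * ((u⁻¹ : ℤ_[p]ˣ) : ℤ_[p]))
  rw [Ideal.mem_span_singleton] at hm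
  obtain ⟨z, hz⟩ := hm
  set m := PadicInt.appr (x * ((u⁻¹ : ℤ_[p]ˣ) : ℤ_[p])) R
  have hm : (m : ℤ_[p]) * u = x - (p:ℤ_[p])^R * (z * u) := by
    have : x * ((u⁻¹ : ℤ_[p]ˣ) : ℤ_[p]) * u = x := by simp
    linear_combination this - u * hz
  obtain ⟨α', β', h'⟩ := pow_expand (β • (1 : Matrix (Fin 2) (Fin 2) ℤ_[p]) + (u:ℤ_[p]) • A) ((p:ℤ_[p])^(k+2)) m
  obtain ⟨d, hd⟩ := Nat.exists_eq_add_of_le hR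
  have hq : (p:ℤ_[p])^(k+2) = p^R * p^d := by rw [hd, pow_add]
  refine ⟨p^k * m, m * β, (p:ℤ_[p])^d • (β' • 1 + α' • (β • (1 : Matrix (Fin 2) (Fin 2) ℤ_[p]) + (u:ℤ_[p]) • A)) - (z * u) • A, ?_⟩
  rw [pow_mul, h, h']
  have hx : x = m * u + (p:ℤ_[p])^R * (z * u) := by rw [hm]; ring
  rw [hx, hq]
  module

lemma mul_approx {R : Type*} [CommRing R] (U V E F : Matrix (Fin 2) (Fin 2) R) (q Q Q' : R) (hq : q = Q * Q') :
    ∃ G, (1 + q • U + (q * Q) • E) * (1 + q • V + (q * Q) • F) = 1 + q • (U + V) + (q * Q) • G := by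
  refine ⟨E + F + Q' • (U * V) + q • (U * F) + q • (E * V) + (q * Q) • (E * F), ?_⟩
  simp only [add_mul, mul_add, smul_mul_assoc, mul_smul_comm, one_mul, mul_one]
  subst hq
  module

lemma cramer {R : Type*} [CommRing R] (x y C : Matrix (Fin 2) (Fin 2) R) :
    ∃ c0 c1 c2 c3 : R, (x*y-y*x).det • C = c0 • (1 : Matrix (Fin 2) (Fin 2) R) + c1 • x + c2 • y + c3 • (x*y) := by
  let D : Matrix (Fin 2) (Fin 2) R → Matrix (Fin 2) (Fin 2) R → Matrix (Fin 2) (Fin 2) R → R :=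
    fun u v w => Matrix.det !![u 0 0 - u 1 1, u 0 1, u 1 0; v 0 0 - v 1 1, v 0 1, v 1 0; w 0 0 - w 1 1, w 0 1, w 1 0]
  have key : (x*y-y*x).det = - D x y (x*y) := by
    simp [D, Matrix.det_fin_two, Matrix.det_fin_three, Matrix.mul_apply, Fin.sum_univ_two]; ring
  have main : ∃ c0 c1 c2 c3 : R, D x y (x*y) • C = c0 • (1 : Matrix (Fin 2) (Fin 2) R) + c1 • x + c2 • y + c3 • (x*y) := by
    generalize x * y = z
    refine ⟨D x y z * C 1 1 - D C y z * x 1 1 - D x C z * y 1 1 - D x y C * z 1 1, D C y z, D x C z, D x y C, ?_⟩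
    ext i j
    fin_cases i <;> fin_cases j <;> simp [D, Matrix.det_fin_three] <;> ring
  obtain ⟨c0, c1, c2, c3, h⟩ := main
  exact ⟨-c0, -c1, -c2, -c3, by rw [key, neg_smul, h]; module⟩

lemma comm_of_det' {R : Type*} [CommRing R] (x y X Y : Matrix (Fin 2) (Fin 2) R)
    (hX : X = x.adjugate) (hY : Y = y.adjugate) (hx : x.det = 1) (hy : y.det = 1)
    (h : (x*y-y*x).det = 0) :
    (x * y * X * Y) * (X * Y * x * y) = (X * Y * x * y) * (x * y * X * Y) := by
  have e1 : x * X = 1 := by rw [hX, Matrix.mul_adjugate, hx, one_smul]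
  have e2 : X * x = 1 := by rw [hX, Matrix.adjugate_mul, hx, one_smul]
  have f1 : y * Y = 1 := by rw [hY, Matrix.mul_adjugate, hy, one_smul]
  have f2 : Y * y = 1 := by rw [hY, Matrix.adjugate_mul, hy, one_smul]
  have z1 : (x*y-y*x) * X = x * (x*y-y*x) := by
    rw [hX, Matrix.adjugate_fin_two]
    ext i j
    fin_cases i <;> fin_cases j <;> simp [Matrix.mul_apply, Fin.sum_univ_two] <;> ring
  have z2 : (x*y-y*x) * Y = y * (x*y-y*x) := by
    rw [hY, Matrix.adjugate_fin_two]
    ext i j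
    fin_cases i <;> fin_cases j <;> simp [Matrix.mul_apply, Fin.sum_univ_two] <;> ring
  have zz : (x*y-y*x) * (x*y-y*x) = 0 := by
    have : (x*y-y*x) * (x*y-y*x) = - (x*y-y*x).det • (1 : Matrix (Fin 2) (Fin 2) R) := by
      ext i j
      fin_cases i <;> fin_cases j <;> simp [Matrix.mul_apply, Fin.sum_univ_two, Matrix.det_fin_two] <;> ring
    rw [this, h]; simp
  have c1 : x * y * X * Y = 1 + (x*y-y*x) * (X * Y) := by
    have : y * x * (X * Y) = 1 := by rw [mul_assoc, ← mul_assoc x, e1, one_mul, f1]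
    rw [sub_mul, this]; noncomm_ring
  have c2 : X * Y * x * y = 1 + X * Y * (x*y-y*x) := by
    have : X * Y * (y * x) = 1 := by rw [mul_assoc, ← mul_assoc Y, f2, one_mul, e2]
    rw [mul_sub, this]; noncomm_ring
  rw [c1, c2]
  generalize x*y-y*x = Z at *
  have k1 : Z * (X * Y) * (X * Y * Z) = 0 := by
    have : Z * (X * Y) * (X * Y * Z) = x * y * x * y * (Z * Z) := by
      calc Z * (X * Y) * (X * Y * Z) = (Z * X) * Y * X * Y * Z := by noncomm_ring
        _ = x * (Z * Y) * X * Y * Z := by rw [z1]; noncomm_ring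
        _ = x * y * (Z * X) * Y * Z := by rw [z2]; noncomm_ring
        _ = x * y * x * (Z * Y) * Z := by rw [z1]; noncomm_ring
        _ = _ := by rw [z2]; noncomm_ring
    rw [this, zz, mul_zero]
  have k2 : (X * Y * Z) * (Z * (X * Y)) = 0 := by
    rw [mul_assoc, ← mul_assoc Z, zz]; simp
  simp only [add_mul, mul_add, k1, k2, one_mul, mul_one]
  abel

lemma comm_of_det {R : Type*} [CommRing R] (x y : SpecialLinearGroup (Fin 2) R)
    (h : (x.1*y.1-y.1*x.1).det = 0) :
    (x * y * x⁻¹ * y⁻¹) * (x⁻¹ * y⁻¹ * x * y) = (x⁻¹ * y⁻¹ * x * y) * (x * y * x⁻¹ * y⁻¹) :=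
  Subtype.ext (comm_of_det' x.1 y.1 (x⁻¹).1 (y⁻¹).1 rfl rfl x.2 y.2 h)

lemma free_ne (N : ℕ) (hN : N ≠ 0) :
    let x := (FreeGroup.of (0 : Fin 2)) ^ N
    let y := (FreeGroup.of (1 : Fin 2)) ^ N
    (x * y * x⁻¹ * y⁻¹) * (x⁻¹ * y⁻¹ * x * y) * ((x⁻¹ * y⁻¹ * x * y) * (x * y * x⁻¹ * y⁻¹))⁻¹ ≠ 1 := by
  intro x y h
  rw [mul_inv_eq_one] at h
  let u : ℚ → (Matrix (Fin 2) (Fin 2) ℚ)ˣ := fun t => ⟨!![1, t; 0, 1], !![1, -t; 0, 1], by simp [Matrix.one_fin_two], by simp [Matrix.one_fin_two]⟩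
  let v : ℚ → (Matrix (Fin 2) (Fin 2) ℚ)ˣ := fun t => ⟨!![1, 0; t, 1], !![1, 0; -t, 1], by simp [Matrix.one_fin_two], by simp [Matrix.one_fin_two]⟩
  have hu : ∀ t (n : ℕ), u t ^ n = u (n * t) := by
    intro t n
    induction n with
    | zero => apply Units.ext; simp [u, Matrix.one_fin_two]
    | succ n ih => 
      rw [pow_succ, ih]; apply Units.ext
      simp [u]; ring
  have hv : ∀ t (n : ℕ), v t ^ n = v (n * t) := by
    intro t n
    induction n with
    | zero => apply Units.ext; simp [v, Matrix.one_fin_two]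
    | succ n ih => 
      rw [pow_succ, ih]; apply Units.ext
      simp [v]; ring
  have hN' : (N:ℚ) ≠ 0 := by exact_mod_cast hN
  have hx : FreeGroup.lift ![u (2 / N), v (2/N)] x = u 2 := by
    simp [x, hu]; congr 1; field_simp
  have hy : FreeGroup.lift ![u (2 / N), v (2/N)] y = v 2 := by
    simp [y, hv]; congr 1; field_simp
  have := congrArg (fun w => (FreeGroup.lift ![u (2 / N), v (2/N)] w : Matrix (Fin 2) (Fin 2) ℚ) 0 1) h
  simp only [map_mul, map_inv, hx, hy] at this
  simp [u, v, Units.inv_mk] at this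
  norm_num at this


lemma dvd_aux (p : ℕ) [Fact p.Prime] (M : ℕ) (μ w z : ℤ_[p]) (hw : w = 2 + (p:ℤ_[p])^2 * z)
    (h : (p:ℤ_[p])^(M+2) ∣ μ * w) : (p:ℤ_[p])^(M+1) ∣ μ := by
  have hp : Prime (p:ℤ_[p]) := PadicInt.prime_p
  have h2 : ¬ (p:ℤ_[p])^2 ∣ w := by
    intro h3
    have h4 : (p:ℤ_[p])^2 ∣ ((2:ℤ) : ℤ_[p]) := by
      have : ((2:ℤ) : ℤ_[p]) = w - (p:ℤ_[p])^2 * z := by rw [hw]; push_cast; ring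
      rw [this]
      exact dvd_sub h3 (dvd_mul_right _ _)
    rw [PadicInt.pow_p_dvd_int_iff] at h4
    have h5 := Int.le_of_dvd (by norm_num) h4
    have h6 : (2:ℤ) ≤ p := by exact_mod_cast (Fact.out : p.Prime).two_le
    nlinarith
  by_cases h1 : (p:ℤ_[p]) ∣ w
  · obtain ⟨w', rfl⟩ := h1
    have h3 : ¬ (p:ℤ_[p]) ∣ w' := by
      rintro ⟨v, rfl⟩
      exact h2 ⟨v, by ring⟩
    have h4 : (p:ℤ_[p])^(M+1) ∣ μ * w' := by
      obtain ⟨e, he⟩ := h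
      refine ⟨e, mul_left_cancel₀ hp.ne_zero ?_⟩
      linear_combination he
    exact hp.pow_dvd_of_dvd_mul_right _ h3 h4
  · exact (pow_dvd_pow _ (by omega)).trans (hp.pow_dvd_of_dvd_mul_right _ h1 h)

/-- reduction mod `p ^ n` -/
noncomputable def red (p : ℕ) [Fact p.Prime] (n : ℕ) :
    SpecialLinearGroup (Fin 2) ℤ_[p] →* SpecialLinearGroup (Fin 2) (ZMod (p ^ n)) :=
  SpecialLinearGroup.map (PadicInt.toZModPow n)

lemma red_iff' (n : ℕ) (g h : SpecialLinearGroup (Fin 2) ℤ_[p]) :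
    red p n g = red p n h ↔ ∀ i j, (p:ℤ_[p])^n ∣ g.1 i j - h.1 i j := by
  have key : ∀ a b : ℤ_[p], PadicInt.toZModPow n a = PadicInt.toZModPow n b ↔ (p:ℤ_[p])^n ∣ a - b := by
    intro a b
    rw [← Ideal.mem_span_singleton, ← PadicInt.ker_toZModPow, RingHom.mem_ker, map_sub, sub_eq_zero]
  refine (Matrix.SpecialLinearGroup.ext_iff _ _).trans ?_
  exact forall_congr' fun i => forall_congr' fun j => key _ _

lemma red_iff (n : ℕ) (g h : SpecialLinearGroup (Fin 2) ℤ_[p]) :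
    red p n g = red p n h ↔ ∃ E, g.1 = h.1 + (p:ℤ_[p])^n • E := by
  rw [red_iff']
  constructor
  · intro hh
    choose E hE using hh
    refine ⟨Matrix.of E, ?_⟩
    ext i j
    simp [← hE]
  · rintro ⟨E, hE⟩ i j
    exact ⟨E i j, by rw [hE]; simp⟩

lemma step (x y : SpecialLinearGroup (Fin 2) ℤ_[p]) (hx : red p 2 x = 1) (hy : red p 2 y = 1)
    (hδ : (x.1*y.1-y.1*x.1).det ≠ 0) :
    ∃ N, ∀ M, N ≤ M → ∀ h, red p M h = 1 → ∃ n1 n2 n3 : ℕ,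
      red p (M+1) h = red p (M+1) (x^n1*y^n2*(x*y)^n3) := by
  rw [← map_one (red p 2), red_iff] at hx hy
  obtain ⟨A, hA⟩ := hx
  obtain ⟨B, hB⟩ := hy
  replace hA : x.1 = 1 + (p:ℤ_[p])^2 • A := hA
  replace hB : y.1 = 1 + (p:ℤ_[p])^2 • B := hB
  obtain ⟨C3, hC3⟩ : ∃ C3, x.1 * y.1 = 1 + (p:ℤ_[p])^2 • C3 := by
    refine ⟨A + B + (p:ℤ_[p])^2 • (A*B), ?_⟩
    rw [hA, hB]
    simp only [add_mul, mul_add, smul_mul_assoc, mul_smul_comm, one_mul, mul_one]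
    module
  obtain ⟨r, U, hr⟩ : ∃ (r : ℕ) (U : ℤ_[p]ˣ), (x.1*y.1-y.1*x.1).det = U * (p:ℤ_[p])^r :=
    ⟨_, _, PadicInt.unitCoeff_spec hδ⟩
  have span : ∀ C : Matrix (Fin 2) (Fin 2) ℤ_[p], ∃ c0 c1 c2 c3 : ℤ_[p],
      (p:ℤ_[p])^r • C = c0 • (1 : Matrix (Fin 2) (Fin 2) ℤ_[p]) + c1 • A + c2 • B + c3 • C3 := by
    intro C
    obtain ⟨c0, c1, c2, c3, hc⟩ := cramer x.1 y.1 (((U⁻¹ : ℤ_[p]ˣ) : ℤ_[p]) • C)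
    refine ⟨c0+c1+c2+c3, (p:ℤ_[p])^2*c1, (p:ℤ_[p])^2*c2, (p:ℤ_[p])^2*c3, ?_⟩
    have e : (U * (p:ℤ_[p])^r) * ((U⁻¹ : ℤ_[p]ˣ) : ℤ_[p]) = (p:ℤ_[p])^r := by
      have : (U:ℤ_[p]) * ((U⁻¹ : ℤ_[p]ˣ) : ℤ_[p]) = 1 := by simp
      linear_combination (p:ℤ_[p])^r * this
    rw [hr, smul_smul, e, hC3, hA, hB] at hc
    rw [hc]
    module
  refine ⟨2*r+2, fun M hM h hh => ?_⟩
  rw [← map_one (red p M), red_iff] at hh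
  obtain ⟨C, hC⟩ := hh
  replace hC : h.1 = 1 + (p:ℤ_[p])^M • C := hC
  obtain ⟨k, rfl⟩ : ∃ k, M = k + 2 + r := ⟨M - r - 2, by omega⟩
  obtain ⟨c0, c1, c2, c3, hc⟩ := span C
  obtain ⟨n1, s1, E1, h1⟩ := approx x.1 A hA k (r+2) (by omega) c1
  obtain ⟨n2, s2, E2, h2⟩ := approx y.1 B hB k (r+2) (by omega) c2
  obtain ⟨n3, s3, E3, h3⟩ := approx (x.1*y.1) C3 hC3 k (r+2) (by omega) c3
  refine ⟨n1, n2, n3, ?_⟩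
  set g := x^n1*y^n2*(x*y)^n3 with hg
  have hgv : g.1 = x.1^n1*y.1^n2*(x.1*y.1)^n3 := rfl
  have hq : (p:ℤ_[p])^(k+2) = (p:ℤ_[p])^(r+2) * (p:ℤ_[p])^(k-r) := by
    rw [← pow_add]; congr 1; omega
  obtain ⟨E4, h4⟩ := mul_approx (s1 • (1 : Matrix (Fin 2) (Fin 2) ℤ_[p]) + c1 • A)
    (s2 • (1 : Matrix (Fin 2) (Fin 2) ℤ_[p]) + c2 • B) E1 E2 _ _ _ hq
  obtain ⟨E5, h5⟩ := mul_approx (s1 • (1 : Matrix (Fin 2) (Fin 2) ℤ_[p]) + c1 • A +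
    (s2 • (1 : Matrix (Fin 2) (Fin 2) ℤ_[p]) + c2 • B))
    (s3 • (1 : Matrix (Fin 2) (Fin 2) ℤ_[p]) + c3 • C3) E4 E3 _ _ _ hq
  rw [h1, h2, h3, h4, h5] at hgv
  have hd : g.1.det = 1 := g.2
  have hd' : h.1.det = 1 := h.2
  rw [red_iff]
  clear_value g
  obtain ⟨μ, hμ⟩ : ∃ μ, μ = (p:ℤ_[p])^(k+2) * (c0 - s1 - s2 - s3) := ⟨_, rfl⟩
  have hhg : h.1 = g.1 + μ • (1 : Matrix (Fin 2) (Fin 2) ℤ_[p]) - (p:ℤ_[p])^(k+2+r+2) • E5 := by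
    have e : (p:ℤ_[p])^(k+2+r) • C = (p:ℤ_[p])^(k+2) • ((p:ℤ_[p])^r • C) := by
      rw [smul_smul, pow_add]
    rw [hC, e, hc, hgv, hμ]
    module
  obtain ⟨F, hF⟩ : ∃ F, g.1 = 1 + (p:ℤ_[p])^2 • F := by
    refine ⟨_, hgv.trans (?_ : _ = 1 + (p:ℤ_[p])^2 • ((p:ℤ_[p])^k • ((s1 • (1 : Matrix (Fin 2) (Fin 2) ℤ_[p]) + c1 • A +
      (s2 • (1 : Matrix (Fin 2) (Fin 2) ℤ_[p]) + c2 • B)) +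
      (s3 • (1 : Matrix (Fin 2) (Fin 2) ℤ_[p]) + c3 • C3)) + ((p:ℤ_[p])^k * (p:ℤ_[p])^(r+2)) • E5))⟩
    module
  have hdvd : (p:ℤ_[p])^(k+2+r+1) ∣ μ := by
    refine dvd_aux p (k+2+r) μ (g.1 0 0 + g.1 1 1 + μ)
      (F 0 0 + F 1 1 + (p:ℤ_[p])^k * (c0 - s1 - s2 - s3)) ?_ ?_
    · rw [hF, hμ]; simp; ring
    · rw [hhg, Matrix.det_fin_two] at hd'
      rw [Matrix.det_fin_two] at hd
      simp only [Matrix.sub_apply, Matrix.add_apply, Matrix.smul_apply, smul_eq_mul, Matrix.one_apply_eq,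
        Matrix.one_apply_ne (show (0:Fin 2) ≠ 1 by decide), Matrix.one_apply_ne (show (1:Fin 2) ≠ 0 by decide), mul_one, mul_zero, add_zero] at hd'
      generalize g.1 = G at *
      set P := (p:ℤ_[p])^(k+2+r+2)
      refine ⟨(G 0 0 + μ) * E5 1 1 + (G 1 1 + μ) * E5 0 0 - P * E5 0 0 * E5 1 1
        - G 0 1 * E5 1 0 - G 1 0 * E5 0 1 + P * E5 0 1 * E5 1 0, ?_⟩
      linear_combination hd' - hd
  obtain ⟨ν, hν⟩ := hdvd
  refine ⟨ν • (1 : Matrix (Fin 2) (Fin 2) ℤ_[p]) - (p:ℤ_[p]) • E5, ?_⟩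
  rw [hhg, hν]
  module

lemma dense_aux (H : Subgroup (SpecialLinearGroup (Fin 2) ℤ_[p]))
    (a b : SpecialLinearGroup (Fin 2) ℤ_[p]) (ha : a ∈ H) (hb : b ∈ H)
    (hfree : ∀ w : FreeGroup (Fin 2), w ≠ 1 → FreeGroup.lift ![a, b] w ≠ 1) :
    ∃ N, ∀ n h, red p N h = 1 → ∃ g ∈ H, red p n h = red p n g := by
  have : NeZero (p^2) := ⟨pow_ne_zero _ (Fact.out : p.Prime).ne_zero⟩
  let N := Nat.card (SpecialLinearGroup (Fin 2) (ZMod (p ^ 2)))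
  have hN : N ≠ 0 := Nat.card_pos.ne'
  have hx : red p 2 (a ^ N) = 1 := by rw [map_pow]; exact pow_card_eq_one'
  have hy : red p 2 (b ^ N) = 1 := by rw [map_pow]; exact pow_card_eq_one'
  obtain ⟨N0, hN0⟩ := step (a^N) (b^N) hx hy (by
    intro h0
    have h1 := comm_of_det _ _ h0
    refine hfree _ (free_ne N hN) ?_
    simp only [map_mul, map_inv, map_pow, FreeGroup.lift_apply_of, Matrix.cons_val_zero, Matrix.cons_val_one]
    rw [h1, mul_inv_cancel])
  refine ⟨N0, fun n h hh => ?_⟩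
  have main : ∀ m, ∃ g ∈ H, red p (N0 + m) h = red p (N0 + m) g := by
    intro m
    induction m with
    | zero => exact ⟨1, H.one_mem, by simpa using hh⟩
    | succ m ih =>
      obtain ⟨g, hg, e⟩ := ih
      obtain ⟨n1, n2, n3, e'⟩ := hN0 (N0 + m) (by omega) (g⁻¹ * h) (by rw [map_mul, map_inv, e, inv_mul_cancel])
      refine ⟨g * ((a^N)^n1*(b^N)^n2*(a^N*b^N)^n3), ?_, ?_⟩
      · have h1 := H.pow_mem ha N
        have h2 := H.pow_mem hb N
        exact H.mul_mem hg (H.mul_mem (H.mul_mem (H.pow_mem h1 _) (H.pow_mem h2 _)) (H.pow_mem (H.mul_mem h1 h2) _))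
      · rw [map_mul, ← add_assoc, ← e', ← map_mul, mul_inv_cancel_left]
  obtain ⟨g, hg, e⟩ := main n
  refine ⟨g, hg, ?_⟩
  rw [red_iff'] at e ⊢
  exact fun i j => (pow_dvd_pow _ (by omega)).trans (e i j)

end S16
end

open S16 in
theorem stmt16 (p : ℕ) [Fact p.Prime]
    (H : Subgroup (Matrix.SpecialLinearGroup (Fin 2) ℤ_[p]))
    (a b : Matrix.SpecialLinearGroup (Fin 2) ℤ_[p]) (ha : a ∈ H) (hb : b ∈ H)
    (hfree : ∀ w : FreeGroup (Fin 2), w ≠ 1 → FreeGroup.lift ![a, b] w ≠ 1) :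
    let _i : TopologicalSpace (Matrix.SpecialLinearGroup (Fin 2) ℤ_[p]) :=
      TopologicalSpace.induced
        (fun g => (g : Matrix (Fin 2) (Fin 2) ℤ_[p])) inferInstance
    IsOpen (closure (H : Set (Matrix.SpecialLinearGroup (Fin 2) ℤ_[p]))) := by
  intro _i
  obtain ⟨N, hN⟩ := dense_aux H a b ha hb hfree
  have hcont : Continuous (fun g : Matrix.SpecialLinearGroup (Fin 2) ℤ_[p] => g.1) :=
    continuous_induced_dom
  have hopen : ∀ n g, IsOpen {h : Matrix.SpecialLinearGroup (Fin 2) ℤ_[p] | red p n h = red p n g} := by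
    intro n g
    have : {h : Matrix.SpecialLinearGroup (Fin 2) ℤ_[p] | red p n h = red p n g} =
        ⋂ i : Fin 2, ⋂ j : Fin 2, {h | ‖h.1 i j - g.1 i j‖ < (p:ℝ) ^ (-(n:ℤ) + 1)} := by
      ext h
      simp only [Set.mem_ofPred_eq, Set.mem_iInter, red_iff', ← PadicInt.norm_le_pow_iff_norm_lt_pow_add_one,
        PadicInt.norm_le_pow_iff_mem_span_pow, Ideal.mem_span_singleton]
    rw [this]
    refine isOpen_iInter_of_finite fun i => isOpen_iInter_of_finite fun j => ?_
    have hc : Continuous (fun h : Matrix.SpecialLinearGroup (Fin 2) ℤ_[p] => h.1 i j) :=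
      hcont.matrix_elem i j
    exact isOpen_lt (hc.sub continuous_const).norm continuous_const
  have hmem : ∀ g, g ∈ closure (H : Set (Matrix.SpecialLinearGroup (Fin 2) ℤ_[p])) ↔
      ∀ n, ∃ s ∈ H, red p n s = red p n g := by
    intro g
    constructor
    · intro hg n
      obtain ⟨s, h1, h2⟩ := mem_closure_iff.1 hg _ (hopen n g) rfl
      exact ⟨s, h2, h1⟩
    · intro hs
      choose s hsH hs using hs
      refine mem_closure_of_tendsto (f := s) (b := Filter.atTop) ?_ (Filter.Eventually.of_forall hsH)
      rw [nhds_induced, Filter.tendsto_comap_iff]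
      refine tendsto_pi_nhds.2 fun i => tendsto_pi_nhds.2 fun j => ?_
      rw [tendsto_iff_norm_sub_tendsto_zero]
      have hp : (1:ℝ) < p := by exact_mod_cast (Fact.out : p.Prime).one_lt
      refine squeeze_zero (g := fun n : ℕ => ((p:ℝ)⁻¹)^n) (fun n => norm_nonneg _) (fun n => ?_)
        (tendsto_pow_atTop_nhds_zero_of_lt_one (by positivity) (inv_lt_one_of_one_lt₀ hp))
      have := (red_iff' _ _ _).1 (hs n) i j
      rw [← Ideal.mem_span_singleton, ← PadicInt.norm_le_pow_iff_mem_span_pow] at this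
      simpa using this
  rw [isOpen_iff_forall_mem_open]
  intro g hg
  refine ⟨{h | red p N h = red p N g}, ?_, hopen N g, rfl⟩
  intro h hh
  rw [hmem] at hg ⊢
  intro n
  obtain ⟨s, hsH, hs⟩ := hg (N + n)
  have hs1 : red p N s = red p N g := by
    rw [red_iff'] at hs ⊢
    exact fun i j => (pow_dvd_pow _ (by omega)).trans (hs i j)
  obtain ⟨t, ht, e⟩ := hN n (s⁻¹ * h) (by rw [map_mul, map_inv, hs1, hh, inv_mul_cancel])
  exact ⟨s * t, H.mul_mem hsH ht, by rw [map_mul, ← e, ← map_mul, mul_inv_cancel_left]⟩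
end
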